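/- arXiv:2307.13507 — 8 statements merged into one kernel-verified Lean document; each statement's English description precedes it below -/
import Mathlib

section
/- Let F_q be a finite field, n ≥ 1, and λ ∈ F_q with λ² = 1. Let C ⊆ F_q^n be a λ-constacyclic code. Then C is LCD, i.e. C ∩ C^⊥ = {0} where C^⊥ is the Euclidean dual, if and only if there exists e ∈ F_q[X]/(X^n − λ) with e² = e, τ(e) = e, and φ(C) equal to the ideal generated by e. -/
open Polynomial AdjoinRoot

/-- The λ-constacyclic shift: `(c₀,…,c_{n−1}) ↦ (λ·c_{n−1}, c₀,…,c_{n−2})`. -/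
def constaShift {F : Type*} [Mul F] {n : ℕ} [NeZero n] (lam : F) (c : Fin n → F) :
    Fin n → F :=
  fun i => if i = 0 then lam * c (i - 1) else c (i - 1)

/-- A submodule `C ⊆ F^n` is λ-constacyclic if it is closed under the λ-constacyclic shift. -/
def IsConstacyclic {F : Type*} [CommRing F] {n : ℕ} [NeZero n] (lam : F)
    (C : Submodule F (Fin n → F)) : Prop :=
  ∀ c ∈ C, constaShift lam c ∈ C

/-- The `R`-linear map `(c₀,…,c_{n−1}) ↦ Σ cᵢ xⁱ` into `R[X]/(f)`, `x` the image of `X`. -/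
noncomputable def phiMap (R : Type*) [CommRing R] (n : ℕ) (f : R[X]) :
    (Fin n → R) →ₗ[R] AdjoinRoot f where
  toFun c := ∑ i : Fin n, c i • root f ^ (i : ℕ)
  map_add' a b := by simp [add_smul, Finset.sum_add_distrib]
  map_smul' r a := by simp [smul_smul, Finset.smul_sum]

/-- The Euclidean dual code `C^⊥ = {y : ∀ c ∈ C, Σ cᵢ yᵢ = 0}`. -/
def eucDual {F : Type*} [CommRing F] {n : ℕ} (C : Submodule F (Fin n → F)) :
    Submodule F (Fin n → F) where
  carrier := {y | ∀ c ∈ C, ∑ i, c i * y i = 0}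
  add_mem' := by
    intro a b ha hb c hc
    simp only [Pi.add_apply, mul_add, Finset.sum_add_distrib]
    simp [ha c hc, hb c hc]
  zero_mem' := by intro c hc; simp
  smul_mem' := by
    intro r y hy c hc
    simp only [Pi.smul_apply, smul_eq_mul, mul_left_comm]
    rw [← Finset.mul_sum, hy c hc, mul_zero]

section helpers

variable {F : Type*} [Field F] {n : ℕ} [NeZero n] {lam : F}

lemma phiMap_eq_mk (f : F[X]) (c : Fin n → F) :
    phiMap F n f c = AdjoinRoot.mk f ((degreeLTEquiv F n).symm c : F[X]) := by
  simp [phiMap, degreeLTEquiv, map_sum, ← C_mul_X_pow_eq_monomial, Algebra.smul_def,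
    AdjoinRoot.algebraMap_eq]

lemma phiMap_bijective (lam : F) :
    Function.Bijective (phiMap F n (X ^ n - Polynomial.C lam)) := by
  have hn : n ≠ 0 := NeZero.ne n
  have hm : (X ^ n - Polynomial.C lam).Monic := monic_X_pow_sub_C lam hn
  have hd : (X ^ n - Polynomial.C lam).degree = (n : WithBot ℕ) := degree_X_pow_sub_C (Nat.pos_of_ne_zero hn) lam
  constructor
  · rw [injective_iff_map_eq_zero]
    intro c hc
    rw [phiMap_eq_mk, AdjoinRoot.mk_eq_zero] at hc
    have h2 : ((degreeLTEquiv F n).symm c : F[X]).degree < n :=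
      mem_degreeLT.1 ((degreeLTEquiv F n).symm c).2
    have h3 := eq_zero_of_dvd_of_degree_lt hc (by rw [hd]; exact h2)
    have h4 : (degreeLTEquiv F n).symm c = 0 := Subtype.ext h3
    simpa using h4
  · intro z
    obtain ⟨p, rfl⟩ := AdjoinRoot.mk_surjective z
    have h2 : p %ₘ (X ^ n - Polynomial.C lam) ∈ degreeLT F n := by
      rw [mem_degreeLT, ← hd]; exact degree_modByMonic_lt _ hm
    refine ⟨degreeLTEquiv F n ⟨_, h2⟩, ?_⟩
    rw [phiMap_eq_mk, LinearEquiv.symm_apply_apply, AdjoinRoot.mk_eq_mk]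
    have := modByMonic_add_div p (X ^ n - Polynomial.C lam)
    refine ⟨-(p /ₘ (X ^ n - Polynomial.C lam)), ?_⟩
    linear_combination this

lemma root_pow_n (lam : F) : root (X ^ n - Polynomial.C lam) ^ n =
    algebraMap F (AdjoinRoot (X ^ n - Polynomial.C lam)) lam := by
  have := AdjoinRoot.eval₂_root (X ^ n - Polynomial.C lam)
  simp only [eval₂_sub, eval₂_pow, eval₂_X, eval₂_C] at this
  rw [AdjoinRoot.algebraMap_eq]
  exact sub_eq_zero.1 this

lemma phiMap_shift (c : Fin n → F) :
    phiMap F n (X ^ n - Polynomial.C lam) (constaShift lam c) =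
      root (X ^ n - Polynomial.C lam) * phiMap F n (X ^ n - Polynomial.C lam) c := by
  have hx := root_pow_n (n := n) lam
  generalize (X ^ n - Polynomial.C lam) = f at *
  obtain ⟨m, rfl⟩ := Nat.exists_eq_succ_of_ne_zero (NeZero.ne n)
  simp only [phiMap, LinearMap.coe_mk, AddHom.coe_mk]
  rw [Fin.sum_univ_succ, Fin.sum_univ_castSucc, mul_add, add_comm]
  congr 1
  · rw [Finset.mul_sum]
    refine Finset.sum_congr rfl fun i _ => ?_
    have : i.succ - 1 = i.castSucc := by
      rw [sub_eq_iff_eq_add]; exact (Fin.coeSucc_eq_succ).symm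
    simp only [constaShift, Fin.succ_ne_zero, if_false, this, Fin.val_succ, Fin.val_castSucc]
    rw [mul_smul_comm, pow_succ']
  · have : (0 : Fin (m+1)) - 1 = Fin.last m := by
      rw [sub_eq_iff_eq_add]; simp
    simp only [constaShift, if_true, this, Fin.val_last]
    rw [mul_smul_comm, ← pow_succ']
    have hx' : root f ^ (m+1) = algebraMap F _ lam := hx
    rw [hx', Algebra.smul_def, Algebra.smul_def]
    simp [mul_comm]

noncomputable def phiEquiv (n : ℕ) [NeZero n] (lam : F) :
    (Fin n → F) ≃ₗ[F] AdjoinRoot (X ^ n - Polynomial.C lam) :=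
  LinearEquiv.ofBijective _ (phiMap_bijective (n := n) lam)

noncomputable def epsMap (n : ℕ) [NeZero n] (lam : F) :
    AdjoinRoot (X ^ n - Polynomial.C lam) →ₗ[F] F :=
  (LinearMap.proj (0 : Fin n)).comp (phiEquiv n lam).symm.toLinearMap

lemma eps_phi (c : Fin n → F) :
    epsMap n lam (phiMap F n (X ^ n - Polynomial.C lam) c) = c 0 := by
  have : phiMap F n (X ^ n - Polynomial.C lam) c = phiEquiv n lam c := rfl
  simp [epsMap, this]

lemma eps_pow (i : ℕ) (hi : i < n) :
    epsMap n lam (root (X ^ n - Polynomial.C lam) ^ i) = if i = 0 then 1 else 0 := by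
  have : root (X ^ n - Polynomial.C lam) ^ i =
      phiMap F n (X ^ n - Polynomial.C lam) (Pi.single ⟨i, hi⟩ 1) := by
    simp [phiMap, Pi.single_apply, ite_smul]
  rw [this, eps_phi, Pi.single_apply]
  simp [Fin.ext_iff, eq_comm]

lemma eps_bilin (hlam : lam ^ 2 = 1)
    (τ : AdjoinRoot (X ^ n - Polynomial.C lam) →ₐ[F] AdjoinRoot (X ^ n - Polynomial.C lam))
    (hτ : τ (root (X ^ n - Polynomial.C lam)) =
      algebraMap F (AdjoinRoot (X ^ n - Polynomial.C lam)) lam *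
        root (X ^ n - Polynomial.C lam) ^ (n - 1))
    (hxy : root (X ^ n - Polynomial.C lam) * τ (root (X ^ n - Polynomial.C lam)) = 1)
    (c d : Fin n → F) :
    epsMap n lam (phiMap F n (X ^ n - Polynomial.C lam) c *
      τ (phiMap F n (X ^ n - Polynomial.C lam) d)) = ∑ i, c i * d i := by
  have key : ∀ i j : Fin n, epsMap n lam (root (X ^ n - Polynomial.C lam) ^ (i : ℕ) *
      τ (root (X ^ n - Polynomial.C lam)) ^ (j : ℕ)) = if i = j then 1 else 0 := by
    intro i j
    have hx := root_pow_n (n := n) lam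
    rcases le_or_gt j i with h | h
    · have h' : (j : ℕ) ≤ i := h
      obtain ⟨k, hk⟩ := Nat.exists_eq_add_of_le h'
      rw [hk, add_comm, pow_add, mul_assoc, ← mul_pow, hxy, one_pow, mul_one, eps_pow _ (by omega)]
      congr 1
      rw [Fin.ext_iff]
      apply propext; omega
    · have h' : (i : ℕ) < j := h
      obtain ⟨k, hk⟩ := Nat.exists_eq_add_of_le h'.le
      have hkn : k + (n - k) = n := by omega
      have hyk : τ (root (X ^ n - Polynomial.C lam)) ^ k =
          lam • root (X ^ n - Polynomial.C lam) ^ (n - k) := by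
        have hl : algebraMap F (AdjoinRoot (X ^ n - Polynomial.C lam)) lam *
            algebraMap F (AdjoinRoot (X ^ n - Polynomial.C lam)) lam = 1 := by
          rw [← map_mul, ← pow_two, hlam, map_one]
        have h1 : τ (root (X ^ n - Polynomial.C lam)) ^ k *
            root (X ^ n - Polynomial.C lam) ^ k = 1 := by
          rw [← mul_pow, mul_comm, hxy, one_pow]
        have h2 : root (X ^ n - Polynomial.C lam) ^ k * root (X ^ n - Polynomial.C lam) ^ (n - k)
            = algebraMap F (AdjoinRoot (X ^ n - Polynomial.C lam)) lam := by
          rw [← pow_add, hkn, hx]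
        rw [Algebra.smul_def]
        generalize τ (root (X ^ n - Polynomial.C lam)) ^ k = u at *
        generalize root (X ^ n - Polynomial.C lam) ^ k = v at *
        generalize root (X ^ n - Polynomial.C lam) ^ (n - k) = w at *
        generalize algebraMap F (AdjoinRoot (X ^ n - Polynomial.C lam)) lam = l at *
        linear_combination (-u) * hl + l * w * h1 - l * u * h2
      rw [hk, pow_add, ← mul_assoc, ← mul_pow, hxy, one_pow, one_mul, hyk, map_smul,
        eps_pow _ (by omega), if_neg (by omega), if_neg (by rw [Fin.ext_iff]; omega), smul_zero]
  simp only [phiMap, LinearMap.coe_mk, AddHom.coe_mk, map_sum, map_smul, map_pow,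
    Finset.sum_mul, Finset.mul_sum, smul_mul_assoc, mul_smul_comm, key]
  simp [mul_comm]

/-- A constacyclic code maps to an ideal. -/
lemma mul_mem_image {C : Submodule F (Fin n → F)} (hC : IsConstacyclic lam C)
    (z a : AdjoinRoot (X ^ n - Polynomial.C lam))
    (ha : a ∈ C.map (phiMap F n (X ^ n - Polynomial.C lam))) :
    z * a ∈ C.map (phiMap F n (X ^ n - Polynomial.C lam)) := by
  have hx : ∀ a ∈ C.map (phiMap F n (X ^ n - Polynomial.C lam)),
      root (X ^ n - Polynomial.C lam) * a ∈ C.map (phiMap F n (X ^ n - Polynomial.C lam)) := by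
    rintro _ ⟨c, hc, rfl⟩
    exact ⟨_, hC c hc, phiMap_shift c⟩
  have hp : ∀ k : ℕ, root (X ^ n - Polynomial.C lam) ^ k * a ∈
      C.map (phiMap F n (X ^ n - Polynomial.C lam)) := by
    intro k
    induction k with
    | zero => simpa using ha
    | succ k ih => rw [pow_succ', mul_assoc]; exact hx _ ih
  obtain ⟨d, rfl⟩ := (phiMap_bijective (n := n) lam).2 z
  simp only [phiMap, LinearMap.coe_mk, AddHom.coe_mk, Finset.sum_mul, smul_mul_assoc]
  exact Submodule.sum_mem _ fun i _ => Submodule.smul_mem _ _ (hp i)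

lemma exists_decomp {C : Submodule F (Fin n → F)} (h : C ⊓ eucDual C = ⊥) (v : Fin n → F) :
    ∃ c ∈ C, ∃ d ∈ eucDual C, c + d = v := by
  let B : LinearMap.BilinForm F (Fin n → F) := dotProductBilin F F
  have hB : ∀ a b, B a b = ∑ i, a i * b i := fun a b => rfl
  have hr : B.IsRefl := by
    intro a b hab
    rw [hB] at *
    simpa only [mul_comm] using hab
  have ho : B.orthogonal C = eucDual C := by
    ext y
    rfl
  have hc := (LinearMap.BilinForm.isCompl_orthogonal_iff_disjoint hr (W := C)).2
    (by rw [ho, disjoint_iff]; exact h)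
  rw [ho] at hc
  have : v ∈ C ⊔ eucDual C := by rw [hc.sup_eq_top]; trivial
  exact Submodule.mem_sup.1 this

end helpers

/-- Over a finite field `F_q`, with `λ² = 1` and `C` a λ-constacyclic code,
`C` is LCD (i.e. `C ∩ C^⊥ = {0}`) iff `φ(C)` is the ideal of `F_q[X]/(Xⁿ − λ)` generated by
an idempotent `e` fixed by the classical involution `τ` (the algebra endomorphism with
`τ(x) = λ·x^{n−1}`). -/
theorem constacyclic_lcd_iff_idempotent (F : Type*) [Field F] [Fintype F]
    (n : ℕ) [NeZero n] (lam : F) (hlam : lam ^ 2 = 1)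
    (C : Submodule F (Fin n → F)) (hC : IsConstacyclic lam C)
    (τ : AdjoinRoot (X ^ n - Polynomial.C lam) →ₐ[F] AdjoinRoot (X ^ n - Polynomial.C lam))
    (hτ : τ (root (X ^ n - Polynomial.C lam)) =
      algebraMap F (AdjoinRoot (X ^ n - Polynomial.C lam)) lam *
        root (X ^ n - Polynomial.C lam) ^ (n - 1)) :
    C ⊓ eucDual C = ⊥ ↔
      ∃ e : AdjoinRoot (X ^ n - Polynomial.C lam),
        e * e = e ∧ τ e = e ∧
          ((Ideal.span {e} : Ideal (AdjoinRoot (X ^ n - Polynomial.C lam))) :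
              Set (AdjoinRoot (X ^ n - Polynomial.C lam))) =
            (phiMap F n (X ^ n - Polynomial.C lam)) '' (C : Set (Fin n → F)) := by
  have hl : algebraMap F (AdjoinRoot (X ^ n - Polynomial.C lam)) lam *
      algebraMap F (AdjoinRoot (X ^ n - Polynomial.C lam)) lam = 1 := by
    rw [← map_mul, ← pow_two, hlam, map_one]
  have hxy : root (X ^ n - Polynomial.C lam) * τ (root (X ^ n - Polynomial.C lam)) = 1 := by
    rw [hτ, mul_left_comm, ← pow_succ', Nat.sub_add_cancel (Nat.pos_of_ne_zero (NeZero.ne n)),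
      root_pow_n, hl]
  have hττ : ∀ z, τ (τ z) = z := by
    have h1 : τ (root (X ^ n - Polynomial.C lam)) *
        τ (τ (root (X ^ n - Polynomial.C lam))) = 1 := by
      rw [← map_mul, hxy, map_one]
    have h2 : τ (τ (root (X ^ n - Polynomial.C lam))) = root (X ^ n - Polynomial.C lam) := by
      linear_combination root (X ^ n - Polynomial.C lam) * h1 -
        τ (τ (root (X ^ n - Polynomial.C lam))) * hxy
    have h3 : τ.comp τ = AlgHom.id F _ := AdjoinRoot.algHom_ext h2
    intro z
    exact DFunLike.congr_fun h3 z
  have hbil := eps_bilin hlam τ hτ hxy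
  have hsurj := (phiMap_bijective (n := n) lam).2
  have hinj := (phiMap_bijective (n := n) lam).1
  have hnd : ∀ z, (∀ a, epsMap n lam (a * z) = 0) → z = 0 := by
    intro z hz
    obtain ⟨d, hd⟩ := hsurj (τ z)
    have hd0 : d = 0 := by
      funext i
      have := hz (phiMap F n (X ^ n - Polynomial.C lam) (Pi.single i 1))
      rw [← hττ z, ← hd, hbil] at this
      simpa [Pi.single_apply] using this
    rw [← hττ z, ← hd, hd0, map_zero, map_zero]
  have hI := mul_mem_image hC
  have hdual : ∀ d, d ∈ eucDual C ↔ ∀ a ∈ C.map (phiMap F n (X ^ n - Polynomial.C lam)),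
      a * τ (phiMap F n (X ^ n - Polynomial.C lam) d) = 0 := by
    intro d
    constructor
    · intro hd a ha
      apply hnd
      intro b
      obtain ⟨c, hc, hc'⟩ := hI b a ha
      rw [← mul_assoc, ← hc', hbil]
      exact hd c hc
    · intro hd c hc
      rw [← hbil, hd _ ⟨c, hc, rfl⟩, map_zero]
  constructor
  · intro h
    obtain ⟨v, hv⟩ := hsurj 1
    obtain ⟨c, hc, d, hd, hcd⟩ := exists_decomp h v
    obtain ⟨e, he⟩ : ∃ e, e = phiMap F n (X ^ n - Polynomial.C lam) c := ⟨_, rfl⟩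
    obtain ⟨g, hg⟩ : ∃ g, g = phiMap F n (X ^ n - Polynomial.C lam) d := ⟨_, rfl⟩
    have heg : e + g = 1 := by rw [he, hg, ← map_add, hcd, hv]
    have heI : e ∈ C.map (phiMap F n (X ^ n - Polynomial.C lam)) := ⟨c, hc, he.symm⟩
    have hgD := (hdual d).1 hd
    rw [← hg] at hgD
    have hag : ∀ a ∈ C.map (phiMap F n (X ^ n - Polynomial.C lam)), a * g = 0 := by
      intro a ha
      have h1 : a * g ∈ C.map (phiMap F n (X ^ n - Polynomial.C lam)) := by
        rw [mul_comm]; exact hI g a ha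
      obtain ⟨w, hw, hw'⟩ := h1
      have hw2 : w ∈ eucDual C := by
        rw [hdual, hw']
        intro b hb
        rw [map_mul, mul_left_comm, hgD b hb, mul_zero]
      have : w ∈ C ⊓ eucDual C := ⟨hw, hw2⟩
      rw [h, Submodule.mem_bot] at this
      rw [← hw', this, map_zero]
    have hae : ∀ a ∈ C.map (phiMap F n (X ^ n - Polynomial.C lam)), a * e = a := by
      intro a ha
      linear_combination a * heg - hag a ha
    have h5 : τ e + τ g = 1 := by rw [← map_add, heg, map_one]
    have h6 : e * τ e = e := by linear_combination e * h5 - hgD e heI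
    have h7 : τ e * e = τ e := by
      have := congrArg τ h6
      rwa [map_mul, hττ] at this
    refine ⟨e, hae e heI, by rw [← h7, mul_comm, h6], ?_⟩
    ext a
    rw [SetLike.mem_coe, Ideal.mem_span_singleton']
    constructor
    · rintro ⟨b, rfl⟩
      exact hI b e heI
    · intro ha
      exact ⟨a, hae a ha⟩
  · rintro ⟨e, hee, hte, hs⟩
    rw [eq_bot_iff]
    rintro w ⟨hw, hw2⟩
    have heI : e ∈ (phiMap F n (X ^ n - Polynomial.C lam)) '' (C : Set (Fin n → F)) := by
      rw [← hs]; exact Ideal.mem_span_singleton_self e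
    have hwI : phiMap F n (X ^ n - Polynomial.C lam) w ∈
        ((Ideal.span {e} : Ideal (AdjoinRoot (X ^ n - Polynomial.C lam))) : Set _) := by
      rw [hs]; exact ⟨w, hw, rfl⟩
    obtain ⟨b, hb⟩ := Ideal.mem_span_singleton'.1 hwI
    have h1 := congrArg τ ((hdual w).1 hw2 e heI)
    rw [map_mul, hττ, hte, map_zero, ← hb] at h1
    rw [Submodule.mem_bot]
    apply hinj
    rw [map_zero, ← hb]
    linear_combination h1 - b * hee
end

section
/- Let F_q be the finite field with q = p^m elements (p prime), let 0 ≤ k < m, let n ≥ 1, and let λ be a nonzero element of F_q. If C ⊆ F_q^n is a λ-constacyclic code, then its k-Galois dual C^{⊥_k} is a λ^{−p^{m−k}}-constacyclic code, i.e. μ-constacyclic where μ = (λ⁻¹)^{p^{m−k}}. -/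
/-- The `k`-Galois dual of `C`, as a set: `C^{⊥_k} = {y : ∀ c ∈ C, Σ cᵢ·yᵢ^{p^k} = 0}`. -/
def galDualSet {F : Type*} [CommRing F] {n : ℕ} (p k : ℕ)
    (C : Submodule F (Fin n → F)) : Set (Fin n → F) :=
  {y | ∀ c ∈ C, ∑ i, c i * y i ^ p ^ k = 0}

/-- Over the finite field with `q = p^m` elements, `0 ≤ k < m`, and a
nonzero `λ`: if `C ⊆ F_q^n` is λ-constacyclic, then its `k`-Galois dual is
`λ^{−p^{m−k}}`-constacyclic, i.e. closed under the `(λ⁻¹)^{p^{m−k}}`-constacyclic shift. -/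
theorem galois_dual_constacyclic (p m : ℕ) (hp : p.Prime)
    (F : Type*) [Field F] [Fintype F] (hF : Fintype.card F = p ^ m)
    (k : ℕ) (hk : k < m) (n : ℕ) [NeZero n] (lam : F) (hlam : lam ≠ 0)
    (C : Submodule F (Fin n → F)) (hC : IsConstacyclic lam C) :
    ∀ y ∈ galDualSet p k C, constaShift (lam⁻¹ ^ p ^ (m - k)) y ∈ galDualSet p k C := by
  classical
  intro y hy c hc
  have hinj : Function.Injective (constaShift (n := n) lam) := by
    intro a b hab
    funext j
    have h := congrFun hab (j + 1)
    simp only [constaShift, add_sub_cancel_right] at h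
    split_ifs at h
    · exact mul_left_cancel₀ hlam h
    · exact h
  let T : C → C := fun c => ⟨constaShift lam c.1, hC c.1 c.2⟩
  have hTinj : Function.Injective T := by
    intro a b hab
    exact Subtype.ext (hinj (congrArg Subtype.val hab))
  obtain ⟨d, hd⟩ := (Finite.injective_iff_surjective.mp hTinj) ⟨c, hc⟩
  have hd' : constaShift lam d.1 = c := congrArg Subtype.val hd
  have hpow : (lam⁻¹ ^ p ^ (m - k)) ^ p ^ k = lam⁻¹ := by
    rw [← pow_mul, ← pow_add, Nat.sub_add_cancel hk.le, ← hF, FiniteField.pow_card]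
  have h0 := hy d.1 d.2
  rw [← hd', ← h0, ← Equiv.sum_comp (Equiv.addRight (1 : Fin n))]
  refine Finset.sum_congr rfl fun i _ => ?_
  simp only [constaShift, Equiv.coe_addRight, add_sub_cancel_right]
  split_ifs
  · rw [mul_pow, hpow]
    field_simp
  · rfl
end

section
/- Let F_q be the finite field with q = p^m elements (p prime), let 0 ≤ k < m, let n ≥ 1, and let λ be a nonzero element of F_q with λ^{1+p^{m−k}} ≠ 1. Then every λ-constacyclic code C ⊆ F_q^n is k-Galois LCD, i.e. C ∩ C^{⊥_k} = {0}. -/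
section helpers
open Polynomial

def cShiftLin {F : Type*} [Field F] {n : ℕ} [NeZero n] (lam : F) :
    (Fin n → F) →ₗ[F] (Fin n → F) where
  toFun := constaShift lam
  map_add' a b := by
    ext i; simp only [constaShift, Pi.add_apply]; split_ifs <;> ring
  map_smul' a b := by
    ext i; simp only [constaShift, Pi.smul_apply, smul_eq_mul, RingHom.id_apply]
    split_ifs <;> ring

lemma cShift_pow {F : Type*} [Field F] {n : ℕ} [NeZero n] (lam : F) (j : ℕ) (hj : j < n) :
    ((cShiftLin lam) ^ j) (Pi.single (0 : Fin n) (1 : F)) = Pi.single (⟨j, hj⟩ : Fin n) 1 := by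
  induction j with
  | zero => simp only [pow_zero, Module.End.one_apply]; rfl
  | succ j ih =>
    rw [pow_succ', Module.End.mul_apply, ih (by omega)]
    ext i
    have h1 : (⟨j + 1, hj⟩ : Fin n) = ⟨j, by omega⟩ + 1 := by
      apply Fin.ext
      rw [Fin.val_add, Fin.val_one', Nat.add_mod_mod]
      exact (Nat.mod_eq_of_lt hj).symm
    have h0 : (⟨j + 1, hj⟩ : Fin n) ≠ 0 := by
      intro h
      have := congrArg Fin.val h
      simp at this
    change (if i = 0 then _ else _) = _
    simp only [Pi.single_apply, sub_eq_iff_eq_add, ← h1]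
    by_cases hi : i = 0
    · subst hi; simp [h0.symm]
    · simp [hi]

lemma cShift_pow_n {F : Type*} [Field F] {n : ℕ} [NeZero n] (lam : F) :
    ((cShiftLin lam) ^ n) (Pi.single (0 : Fin n) (1 : F)) = Pi.single (0 : Fin n) lam := by
  have hn : n ≠ 0 := NeZero.ne n
  obtain ⟨r, hr⟩ : ∃ r, n = r + 1 := ⟨n - 1, by omega⟩
  subst hr
  rw [pow_succ', Module.End.mul_apply, cShift_pow lam r (by omega)]
  have h1 : (⟨r, by omega⟩ : Fin (r+1)) + 1 = 0 := by
    apply Fin.ext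
    rw [Fin.val_add, Fin.val_one', Nat.add_mod_mod]
    simp
  ext i
  change (if i = 0 then _ else _) = _
  simp only [Pi.single_apply, sub_eq_iff_eq_add, h1]
  by_cases hi : i = 0 <;> simp [hi]

lemma coeff_mod {F : Type*} [Field F] {n : ℕ} (hn : n ≠ 0) (lam : F) (a : ℕ)
    (ha : a < n - 1 + n) :
    ((X ^ a : F[X]) %ₘ (X ^ n - C lam)).coeff (n - 1) = if a = n - 1 then 1 else 0 := by
  have hm : (X ^ n - C lam : F[X]).Monic := monic_X_pow_sub_C lam hn
  have hd : (X ^ n - C lam : F[X]).degree = n := degree_X_pow_sub_C (by omega) lam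
  by_cases h : a < n
  · rw [(modByMonic_eq_self_iff hm).2, coeff_X_pow]
    · simp [eq_comm]
    · rw [hd, degree_X_pow]; exact_mod_cast h
  · have : (X ^ a : F[X]) %ₘ (X ^ n - C lam) = C lam * X ^ (a - n) := by
      refine (div_modByMonic_unique (X ^ (a - n)) _ hm ⟨?_, ?_⟩).2
      · have : (X ^ a : F[X]) = X ^ n * X ^ (a - n) := by
          rw [← pow_add]; congr 1; omega
        rw [this]; ring
      · rw [hd]
        refine (degree_C_mul_X_pow_le _ _).trans_lt ?_
        exact_mod_cast (by omega : a - n < n)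
    rw [this, coeff_C_mul, coeff_X_pow, if_neg (by omega), if_neg (by omega), mul_zero]

lemma dvd_of_coeff {F : Type*} [Field F] {n : ℕ} (hn : n ≠ 0) (lam : F) (A : F[X])
    (h : ∀ f : F[X], ((f * A) %ₘ (X ^ n - C lam)).coeff (n - 1) = 0) :
    (X ^ n - C lam) ∣ A := by
  have hm : (X ^ n - C lam : F[X]).Monic := monic_X_pow_sub_C lam hn
  have hd : (X ^ n - C lam : F[X]).degree = n := degree_X_pow_sub_C (by omega) lam
  rw [← modByMonic_eq_zero_iff_dvd hm]
  by_contra hR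
  set R := A %ₘ (X ^ n - C lam) with hRdef
  have hRd : R.natDegree < n := by
    have := degree_modByMonic_lt A hm
    rw [hd, ← hRdef] at this
    exact (natDegree_lt_iff_degree_lt hR).2 this
  have h1 := h (X ^ (n - 1 - R.natDegree))
  have h2 : (X ^ (n - 1 - R.natDegree) * A) %ₘ (X ^ n - C lam) = X ^ (n - 1 - R.natDegree) * R := by
    refine (div_modByMonic_unique (X ^ (n - 1 - R.natDegree) * (A /ₘ (X ^ n - C lam))) _ hm ⟨?_, ?_⟩).2
    · have := modByMonic_add_div A (X ^ n - C lam)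
      rw [← hRdef] at this
      conv_rhs => rw [← this]
      ring
    · rw [hd, degree_mul, degree_X_pow, degree_eq_natDegree hR]
      exact_mod_cast (by omega : n - 1 - R.natDegree + R.natDegree < n)
  rw [h2] at h1
  have h3 : n - 1 = R.natDegree + (n - 1 - R.natDegree) := by omega
  rw [h3] at h1
  rw [show R.natDegree + (n - 1 - R.natDegree) - R.natDegree = n - 1 - R.natDegree by omega,
    coeff_X_pow_mul] at h1
  exact hR (leadingCoeff_eq_zero.1 h1)

noncomputable def toPoly {F : Type*} [Field F] {n : ℕ} (y : Fin n → F) : F[X] :=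
  ∑ i : Fin n, C (y i) * X ^ (i : ℕ)

/-- reversed polynomial -/
noncomputable def toPolyR {F : Type*} [Field F] {n : ℕ} (y : Fin n → F) : F[X] :=
  ∑ i : Fin n, C (y i) * X ^ (n - 1 - (i : ℕ))

lemma psi_toPoly {F : Type*} [Field F] {n : ℕ} [NeZero n] (lam : F) (y : Fin n → F) :
    (aeval (cShiftLin lam) (toPoly y)) (Pi.single (0 : Fin n) (1 : F)) = y := by
  simp only [toPoly, map_sum, map_mul, aeval_C, map_pow, aeval_X, LinearMap.sum_apply,
    Module.End.mul_apply, Module.algebraMap_end_apply]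
  ext j
  simp only [fun i : Fin n => cShift_pow lam i.1 i.2, Finset.sum_apply, Pi.smul_apply,
    Pi.single_apply]
  simp

lemma key_dvd {F : Type*} [Field F] {n : ℕ} [NeZero n] (lam : F)
    (Cc : Submodule F (Fin n → F)) (hC : IsConstacyclic lam Cc) (y z : Fin n → F) (hy : y ∈ Cc)
    (hz : ∀ c ∈ Cc, ∑ i, c i * z i = 0) :
    (X ^ n - C lam) ∣ toPoly y * toPolyR z := by
  have hn : n ≠ 0 := NeZero.ne n
  have hm : (X ^ n - C lam : F[X]).Monic := monic_X_pow_sub_C lam hn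
  have hd : (X ^ n - C lam : F[X]).degree = n := degree_X_pow_sub_C (by omega) lam
  set T := cShiftLin (n := n) lam with hT
  set e : Fin n → F := Pi.single 0 1 with he
  have hmem : ∀ f : F[X], ∀ c ∈ Cc, aeval T f c ∈ Cc := by
    intro f c hc
    induction f using Polynomial.induction_on' with
    | add a b ha hb => rw [map_add]; exact Cc.add_mem ha hb
    | monomial j a =>
      rw [aeval_monomial, Module.End.mul_apply, Module.algebraMap_end_apply]
      refine Cc.smul_mem _ ?_
      induction j with
      | zero => simpa using hc
      | succ j ih => rw [pow_succ', Module.End.mul_apply]; exact hC _ ih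
  have hP : ∀ f : F[X], aeval T (f * (X ^ n - C lam)) e = 0 := by
    intro f
    rw [map_mul, Module.End.mul_apply, map_sub, map_pow, aeval_X, aeval_C, LinearMap.sub_apply,
      cShift_pow_n, Module.algebraMap_end_apply, he, ← Pi.single_smul]
    simp
  -- comparison of functionals
  have hLM : ∀ f : F[X], ∑ i, (aeval T f e) i * z i
      = ((f * toPolyR z) %ₘ (X ^ n - C lam)).coeff (n - 1) := by
    have hsmall : ∀ j : ℕ, j < n → ∑ i, (aeval T (X ^ j : F[X]) e) i * z i
      = ((X ^ j * toPolyR z) %ₘ (X ^ n - C lam)).coeff (n - 1) := by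
      intro j hj
      rw [map_pow, aeval_X, cShift_pow lam j hj]
      have : (X ^ j * toPolyR z : F[X]) = ∑ i : Fin n, z i • X ^ (j + (n - 1 - (i : ℕ))) := by
        rw [toPolyR, Finset.mul_sum]
        refine Finset.sum_congr rfl fun i _ => ?_
        rw [smul_eq_C_mul, pow_add]; ring
      rw [this]
      have h2 := map_sum (modByMonicHom (X ^ n - C lam))
        (fun i : Fin n => z i • (X : F[X]) ^ (j + (n - 1 - (i : ℕ)))) Finset.univ
      simp only [modByMonicHom_apply, smul_modByMonic] at h2
      rw [h2, finsetSum_coeff]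
      refine Finset.sum_congr rfl fun i _ => ?_
      rw [coeff_smul, coeff_mod hn lam _ (by omega), Pi.single_apply, smul_eq_mul, mul_comm]
      congr 1
      have : i = ⟨j, hj⟩ ↔ j + (n - 1 - (i : ℕ)) = n - 1 := by
        rw [Fin.ext_iff]; have := i.2; simp only; omega
      simp only [this]
    intro f
    have hf := modByMonic_add_div f (X ^ n - C lam)
    set r := f %ₘ (X ^ n - C lam) with hr
    have e1 : aeval T f e = aeval T r e := by
      rw [← hf, map_add, LinearMap.add_apply, mul_comm, hP, add_zero]
    have e2 : (f * toPolyR z) %ₘ (X ^ n - C lam) = (r * toPolyR z) %ₘ (X ^ n - C lam) := by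
      rw [← sub_eq_zero, ← sub_modByMonic, modByMonic_eq_zero_iff_dvd hm]
      refine ⟨(f /ₘ (X ^ n - C lam)) * toPolyR z, ?_⟩
      conv_lhs => rw [← hf]
      ring
    rw [e1, e2]
    have hrd : r.natDegree < n := by
      have := degree_modByMonic_lt f hm
      rw [hd, ← hr] at this
      by_cases h0 : r = 0
      · rw [h0, natDegree_zero]; omega
      · exact (natDegree_lt_iff_degree_lt h0).2 this
    rw [r.as_sum_range' n hrd]
    simp only [map_sum, LinearMap.sum_apply, Finset.sum_apply, Finset.sum_mul]
    rw [Finset.sum_comm]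
    have h2 := map_sum (modByMonicHom (X ^ n - C lam))
        (fun i : ℕ => (monomial i (r.coeff i)) * toPolyR z) (Finset.range n)
    simp only [modByMonicHom_apply] at h2
    rw [h2, finsetSum_coeff]
    refine Finset.sum_congr rfl fun j hj => ?_
    rw [← smul_X_eq_monomial, smul_mul_assoc, smul_modByMonic, coeff_smul,
      ← hsmall j (Finset.mem_range.1 hj), map_smul, Finset.smul_sum]
    refine Finset.sum_congr rfl fun i _ => ?_
    simp [mul_assoc]
  refine dvd_of_coeff hn lam _ fun f => ?_
  rw [← mul_assoc, ← hLM]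
  refine hz _ ?_
  rw [map_mul, Module.End.mul_apply, psi_toPoly]
  exact hmem _ _ hy

lemma natDegree_toPoly {F : Type*} [Field F] {n : ℕ} (y : Fin n → F) :
    (toPoly y).natDegree ≤ n - 1 :=
  natDegree_sum_le_of_forall_le _ _ fun i _ =>
    (natDegree_C_mul_X_pow_le _ _).trans (by omega)

lemma natDegree_toPolyR {F : Type*} [Field F] {n : ℕ} (y : Fin n → F) :
    (toPolyR y).natDegree ≤ n - 1 :=
  natDegree_sum_le_of_forall_le _ _ fun i _ =>
    (natDegree_C_mul_X_pow_le _ _).trans (by omega)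

lemma reflect_toPolyR {F : Type*} [Field F] {n : ℕ} (y : Fin n → F) :
    reflect (n - 1) (toPolyR y) = toPoly y := by
  have : ∀ s : Finset (Fin n), reflect (n - 1) (∑ i ∈ s, C (y i) * X ^ (n - 1 - (i : ℕ)))
      = ∑ i ∈ s, C (y i) * X ^ (i : ℕ) := by
    intro s
    induction s using Finset.induction_on with
    | empty => simp
    | insert a s ha ih =>
      rw [Finset.sum_insert ha, Finset.sum_insert ha, reflect_add, ih, reflect_C_mul_X_pow,
        revAt_le (by omega)]
      congr 3
      omega
  exact this _

lemma toPoly_eq_zero {F : Type*} [Field F] {n : ℕ} [NeZero n] (y : Fin n → F)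
    (h : toPoly y = 0) : y = 0 := by
  rw [← psi_toPoly (0 : F) y, h]; simp

lemma poly_core {F : Type*} [Field F] {n : ℕ} (hn : n ≠ 0) (lam : F) (hlam : lam ≠ 0)
    (τ : F →+* F) (hτ : lam * τ lam ≠ 1) (Y W : F[X]) (hY : Y.natDegree ≤ n - 1)
    (hW : W.natDegree ≤ n - 1) (hdvd : (X ^ n - C lam) ∣ Y * W)
    (hYW : (reflect (n - 1) W).map τ = Y) : Y = 0 := by
  classical
  by_contra hY0
  have hW0 : W ≠ 0 := by rintro rfl; simp at hYW; exact hY0 hYW.symm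
  have hP0 : (X ^ n - C lam : F[X]) ≠ 0 := (monic_X_pow_sub_C lam hn).ne_zero
  have hPd : (X ^ n - C lam : F[X]).natDegree = n := natDegree_X_pow_sub_C
  obtain ⟨G, Y', H, hYG, hPG, hcop⟩ : ∃ G Y' H : F[X], Y = G * Y' ∧
      X ^ n - C lam = G * H ∧ IsCoprime Y' H := by
    have hg : EuclideanDomain.gcd Y (X ^ n - C lam) ≠ 0 := fun h =>
      hY0 (EuclideanDomain.gcd_eq_zero_iff.1 h).1
    obtain ⟨a, ha⟩ := EuclideanDomain.gcd_dvd_left Y (X ^ n - C lam)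
    obtain ⟨b, hb⟩ := EuclideanDomain.gcd_dvd_right Y (X ^ n - C lam)
    refine ⟨_, a, b, ha, hb, ?_⟩
    have := EuclideanDomain.gcd_eq_gcd_ab Y (X ^ n - C lam)
    set g := EuclideanDomain.gcd Y (X ^ n - C lam)
    refine ⟨EuclideanDomain.gcdA Y (X ^ n - C lam), EuclideanDomain.gcdB Y (X ^ n - C lam), ?_⟩
    apply mul_left_cancel₀ hg
    rw [mul_one]
    conv_rhs => rw [this]
    conv_rhs => enter [1, 1]; rw [ha]
    conv_rhs => enter [2, 1]; rw [hb]
    ring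
  have hG0 : G ≠ 0 := by rintro rfl; simp at hYG; exact hY0 hYG
  have hH0 : H ≠ 0 := by rintro rfl; rw [mul_zero] at hPG; exact hP0 hPG
  have hHW : H ∣ W := by
    rw [hPG, hYG, mul_assoc] at hdvd
    exact hcop.symm.dvd_of_dvd_mul_left ((mul_dvd_mul_iff_left hG0).1 hdvd)
  obtain ⟨Q, hQ⟩ := hHW
  have hQ0 : Q ≠ 0 := by rintro rfl; simp at hQ; exact hW0 hQ
  have hdeg : G.natDegree + H.natDegree = n := by
    rw [← natDegree_mul hG0 hH0, ← hPG, hPd]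
  have hdegW : H.natDegree + Q.natDegree ≤ n - 1 := by
    rw [← natDegree_mul hH0 hQ0, ← hQ]; exact hW
  have hKW : reflect H.natDegree H ∣ reflect (n - 1) W := by
    have h := reflect_mul H Q (F := H.natDegree) (G := n - 1 - H.natDegree) le_rfl (by omega)
    rw [← hQ, show H.natDegree + (n - 1 - H.natDegree) = n - 1 by omega] at h
    exact ⟨_, h⟩
  have hKP : reflect H.natDegree H ∣ 1 - C lam * X ^ n := by
    have h := reflect_mul G H (F := G.natDegree) (G := H.natDegree) le_rfl le_rfl
    rw [← hPG, hdeg, reflect_sub, reflect_C] at h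
    have h1 : reflect n (X ^ n : F[X]) = 1 := by
      have := reflect_C_mul_X_pow n n (c := (1 : F))
      simpa [revAt_le] using this
    rw [h1] at h
    exact ⟨_, h.trans (mul_comm _ _)⟩
  set K := reflect H.natDegree H with hK
  have hKd : K.natDegree = H.natDegree := by
    have hc : H.coeff 0 ≠ 0 := by
      intro h
      have := congrArg (fun f => coeff f 0) hPG
      simp [mul_coeff_zero, h, hn.symm, hlam, coeff_X_pow] at this
    refine le_antisymm ?_ ?_
    · rw [hK, natDegree_le_iff_coeff_eq_zero]
      intro N hN
      rw [coeff_reflect, revAt_eq_self_of_lt hN]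
      exact coeff_eq_zero_of_natDegree_lt hN
    · apply le_natDegree_of_ne_zero
      rw [hK, coeff_reflect, revAt_le le_rfl, Nat.sub_self]
      exact hc
  have hKY : K.map τ ∣ Y := by rw [← hYW]; exact Polynomial.map_dvd τ hKW
  have hKP' : K.map τ ∣ 1 - C (τ lam) * X ^ n := by
    have := Polynomial.map_dvd τ hKP
    simpa using this
  have hcop2 : IsCoprime (X ^ n - C lam) (1 - C (τ lam) * X ^ n) := by
    have hu : 1 - lam * τ lam ≠ 0 := sub_ne_zero.2 hτ.symm
    refine ⟨C ((1 - lam * τ lam)⁻¹ * τ lam), C ((1 - lam * τ lam)⁻¹), ?_⟩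
    have : C ((1 - lam * τ lam)⁻¹) * (1 - C lam * C (τ lam)) = 1 := by
      rw [← C_1, ← C_mul, ← C_sub, ← C_mul, inv_mul_cancel₀ hu]
    rw [C_mul]
    linear_combination this
  have hcop3 : IsCoprime G (K.map τ) :=
    (hcop2.of_isCoprime_of_dvd_left ⟨H, hPG⟩).of_isCoprime_of_dvd_right hKP'
  have hfin := hcop3.mul_dvd ⟨Y', hYG⟩ hKY
  have hle := natDegree_le_of_dvd hfin hY0
  have hK0 : K.map τ ≠ 0 := by
    rintro h; rw [h, zero_dvd_iff] at hKY; exact hY0 hKY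
  rw [natDegree_mul hG0 hK0, natDegree_map, hKd, hdeg] at hle
  omega

end helpers

/-- Over the finite field with `q = p^m` elements, `0 ≤ k < m`, and a
nonzero `λ` with `λ^{1+p^{m−k}} ≠ 1`: every λ-constacyclic code `C ⊆ F_q^n` is `k`-Galois
LCD, i.e. `C ∩ C^{⊥_k} = {0}`. -/
theorem constacyclic_is_kGalois_lcd (p m : ℕ) (hp : p.Prime)
    (F : Type*) [Field F] [Fintype F] (hF : Fintype.card F = p ^ m)
    (k : ℕ) (hk : k < m) (n : ℕ) [NeZero n] (lam : F) (hlam : lam ≠ 0)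
    (hlam' : lam ^ (1 + p ^ (m - k)) ≠ 1)
    (C : Submodule F (Fin n → F)) (hC : IsConstacyclic lam C) :
    ∀ y ∈ C, y ∈ galDualSet p k C → y = 0 := by
  intro y hy hyd
  have hn : n ≠ 0 := NeZero.ne n
  haveI : Fact p.Prime := ⟨hp⟩
  haveI : CharP F p := charP_of_card_eq_prime_pow hF
  have hz : ∀ c ∈ C, ∑ i, c i * (fun i => y i ^ p ^ k) i = 0 := hyd
  have hdvd := key_dvd lam C hC y (fun i => y i ^ p ^ k) hy hz
  apply toPoly_eq_zero
  refine poly_core hn lam hlam (iterateFrobenius F p (m - k)) ?_ _ _ (natDegree_toPoly y)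
    (natDegree_toPolyR _) hdvd ?_
  · rw [iterateFrobenius_def]
    rwa [pow_add, pow_one] at hlam'
  · rw [reflect_toPolyR]
    simp only [toPoly, Polynomial.map_sum, Polynomial.map_mul, Polynomial.map_C,
      Polynomial.map_pow, Polynomial.map_X, iterateFrobenius_def]
    refine Finset.sum_congr rfl fun i _ => ?_
    rw [← pow_mul, ← pow_add, show k + (m - k) = m by omega, ← hF, FiniteField.pow_card]
end

section
/- Let F_q be a finite field, n ≥ 1, and let λ, β be nonzero elements of F_q with λ ≠ β. If a linear code C ⊆ F_q^n is both λ-constacyclic and β-constacyclic, then C = {0} or C = F_q^n. (Equivalently, if C is a nonzero proper code that is both λ-constacyclic and β-constacyclic, then λ = β.) -/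
open Fin.NatCast Fin.CommRing in
theorem fin_cyclic_ind {n : ℕ} [NeZero n] (P : Fin n → Prop) (hs : ∀ i, P i → P (i + 1))
    (i : Fin n) (hi : P i) (j : Fin n) : P j := by
  have key : ∀ k : ℕ, P (i + (k : Fin n)) := by
    intro k
    induction k with
    | zero => simpa using hi
    | succ k ih =>
      have := hs _ ih
      rwa [add_assoc, ← Nat.cast_succ] at this
  have := key (j - i).val
  rwa [Fin.cast_val_eq_self, add_sub_cancel] at this

/-- Over a finite field, if `λ ≠ β` are nonzero and a linear code
`C ⊆ F_q^n` is both λ-constacyclic and β-constacyclic, then `C = {0}` or `C = F_q^n`. -/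
theorem constacyclic_two_constants (F : Type*) [Field F] [Fintype F]
    (n : ℕ) [NeZero n] (lam beta : F) (hlam : lam ≠ 0) (hbeta : beta ≠ 0)
    (hne : lam ≠ beta) (C : Submodule F (Fin n → F))
    (h1 : IsConstacyclic lam C) (h2 : IsConstacyclic beta C) :
    C = ⊥ ∨ C = ⊤ := by
  by_cases hC : C = ⊥
  · exact Or.inl hC
  right
  obtain ⟨v, hv, hv0⟩ := Submodule.exists_mem_ne_zero_of_ne_bot hC
  obtain ⟨i, hi⟩ := Function.ne_iff.mp hv0
  -- some codeword has nonzero last coordinate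
  obtain ⟨w, hw, hw0⟩ : ∃ w ∈ C, w (0 - 1) ≠ 0 := by
    refine fin_cyclic_ind (fun j => ∃ w ∈ C, w j ≠ 0) ?_ i ⟨v, hv, hi⟩ (0 - 1)
    rintro j ⟨w, hw, hj⟩
    refine ⟨_, h1 w hw, ?_⟩
    simp only [constaShift, add_sub_cancel_right]
    split_ifs
    · exact mul_ne_zero hlam hj
    · exact hj
  -- the first basis vector lies in the code
  have he0 : (Pi.single 0 1 : Fin n → F) ∈ C := by
    have hd := C.smul_mem ((lam - beta) * w (0 - 1))⁻¹ (C.sub_mem (h1 w hw) (h2 w hw))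
    convert hd using 1
    funext j
    by_cases hj : j = 0
    · subst hj
      have : lam - beta ≠ 0 := sub_ne_zero.mpr hne
      simp only [constaShift, if_true, Pi.single_eq_same, Pi.smul_apply, Pi.sub_apply,
        smul_eq_mul]
      rw [← sub_mul, inv_mul_cancel₀ (mul_ne_zero this hw0)]
    · simp [constaShift, hj]
  have hall : ∀ j : Fin n, (Pi.single j 1 : Fin n → F) ∈ C := by
    refine fin_cyclic_ind (fun j => (Pi.single j 1 : Fin n → F) ∈ C) ?_ 0 he0
    intro j hj
    have hd := C.smul_mem (if j + 1 = 0 then lam⁻¹ else 1) (h1 _ hj)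
    convert hd using 1
    funext k
    by_cases hk : k = j + 1
    · subst hk
      simp only [constaShift, Pi.single_eq_same, Pi.smul_apply, smul_eq_mul,
        add_sub_cancel_right]
      split_ifs <;> simp [hlam]
    · have : k - 1 ≠ j := fun h => hk (sub_eq_iff_eq_add.mp h)
      simp [constaShift, hk, this]
  rw [eq_top_iff]
  intro x _
  rw [pi_eq_sum_univ' x]
  refine C.sum_mem fun j _ => C.smul_mem _ ?_
  convert hall j using 1
end

section
/- Let R be a commutative ring, n ≥ 1, and let λ, β be units of R. The 2-cocycles γ_λ and γ_β on ZMod n with values in the unit group Rˣ are cohomologous if and only if there exists a unit a of R such that λ = a^n · β. -/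
/-- The 2-cocycle `γ_λ` on `ZMod n`: `γ_λ(i,j) = λ` if `i.val + j.val ≥ n`, else `1`. -/
def gammaL (n : ℕ) {A : Type*} [CommGroup A] (lam : A) : ZMod n → ZMod n → A :=
  fun i j => if n ≤ i.val + j.val then lam else 1

/-- Two 2-cocycles on `ZMod n` (trivial action) are cohomologous if they differ by a
2-coboundary `δ(x)·δ(y)·δ(x+y)⁻¹`. -/
def Cohomologous (n : ℕ) {A : Type*} [CommGroup A]
    (γ₁ γ₂ : ZMod n → ZMod n → A) : Prop :=
  ∃ δ : ZMod n → A, ∀ x y : ZMod n, γ₁ x y = δ x * δ y * (δ (x + y))⁻¹ * γ₂ x y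

/-- For a commutative ring `R`, `n ≥ 1` and units `λ, β` of `R`, the
cocycles `γ_λ` and `γ_β` on `ZMod n` with values in `Rˣ` are cohomologous iff there is a
unit `a` of `R` with `λ = aⁿ·β`. -/
theorem gammaL_cohomologous_iff (R : Type*) [CommRing R] (n : ℕ) [NeZero n]
    (lam beta : Rˣ) :
    Cohomologous n (gammaL n lam) (gammaL n beta) ↔ ∃ a : Rˣ, lam = a ^ n * beta := by
  constructor
  · rintro ⟨δ, h⟩
    rcases Nat.lt_or_ge 1 n with hn | hn
    · haveI : Fact (1 < n) := ⟨hn⟩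
      have h1 : (1 : ZMod n).val = 1 := ZMod.val_one n
      have h0 : δ 0 = 1 := by
        have := h 0 0
        have hz : ¬ n ≤ 0 := by omega
        simpa [gammaL, hz, eq_comm] using this
      have key : ∀ k : ℕ, k < n → δ (k : ZMod n) = δ 1 ^ k := by
        intro k
        induction k with
        | zero => intro _; simpa using h0
        | succ k ih =>
          intro hk
          have e := h (k : ZMod n) 1
          have hv : (k : ZMod n).val = k := ZMod.val_cast_of_lt (by omega)
          have hz : ¬ n ≤ k + 1 := by omega
          simp only [gammaL, hv, h1, if_neg hz, mul_one] at e
          rw [ih (by omega)] at e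
          rw [Nat.cast_succ, pow_succ]
          exact (mul_inv_eq_one.mp e.symm).symm
      refine ⟨δ 1, ?_⟩
      have e := h ((n - 1 : ℕ) : ZMod n) 1
      have hv : ((n - 1 : ℕ) : ZMod n).val = n - 1 := ZMod.val_cast_of_lt (by omega)
      have hz : n ≤ n - 1 + 1 := by omega
      have hs : ((n - 1 : ℕ) : ZMod n) + 1 = 0 := by
        rw [← Nat.cast_succ, Nat.succ_eq_add_one, Nat.sub_add_cancel hn.le, ZMod.natCast_self]
      simp only [gammaL, hv, h1, if_pos hz] at e
      rw [hs, h0, key (n - 1) (by omega), ← pow_succ, Nat.sub_add_cancel hn.le] at e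
      simpa using e
    · have h1 : n = 1 := by
        have := NeZero.ne n
        omega
      exact ⟨lam * beta⁻¹, by simp [h1]⟩
  · rintro ⟨a, rfl⟩
    refine ⟨fun x => a ^ x.val, fun x y => ?_⟩
    by_cases hxy : n ≤ x.val + y.val
    · have hv := ZMod.val_add_val_of_le hxy
      simp only [gammaL, if_pos hxy]
      rw [← pow_add, hv, add_comm (x + y).val n, pow_add]
      simp
    · have hv := ZMod.val_add_of_lt (not_le.mp hxy)
      simp only [gammaL, if_neg hxy]
      rw [hv, pow_add]
      simp
end

section
/- Let R be a commutative ring, n ≥ 1, and let λ be a unit of R. The 2-cocycle γ_λ on ZMod n with values in Rˣ is a 2-coboundary (i.e. cohomologous to the trivial constant cocycle 1) if and only if there exists a unit a of R such that λ = a^n. -/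
/-- For a commutative ring `R`, `n ≥ 1` and a unit `λ` of `R`, the
cocycle `γ_λ` on `ZMod n` with values in `Rˣ` is a 2-coboundary (cohomologous to the
trivial constant cocycle `1`) iff there is a unit `a` of `R` with `λ = aⁿ`. -/
theorem gammaL_coboundary_iff (R : Type*) [CommRing R] (n : ℕ) [NeZero n] (lam : Rˣ) :
    Cohomologous n (gammaL n lam) (fun _ _ => 1) ↔ ∃ a : Rˣ, lam = a ^ n := by
  constructor
  · rintro ⟨δ, h⟩
    have hn : 0 < n := Nat.pos_of_ne_zero (NeZero.ne n)
    rcases Nat.lt_or_ge 1 n with h1 | h1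
    · have h0 : δ 0 = 1 := by
        have := h 0 0
        simp only [gammaL, ZMod.val_zero, add_zero, mul_one, mul_inv_cancel_right] at this
        rw [if_neg (by omega)] at this
        exact this.symm
      haveI : Fact (1 < n) := ⟨h1⟩
      have key : ∀ k : ℕ, k < n → δ (k : ZMod n) = δ 1 ^ k := by
        intro k
        induction k with
        | zero => intro _; simpa using h0
        | succ k ih =>
          intro hk
          have := h (k : ZMod n) 1
          simp only [gammaL, ZMod.val_one, mul_one] at this
          rw [ZMod.val_natCast_of_lt (by omega), if_neg (by omega), ih (by omega)] at this
          have h2 := mul_inv_eq_one.mp this.symm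
          rw [pow_succ, Nat.cast_succ, h2]
      refine ⟨δ 1, ?_⟩
      have := h ((n - 1 : ℕ) : ZMod n) 1
      simp only [gammaL, ZMod.val_one, mul_one] at this
      have hz : ((n - 1 : ℕ) : ZMod n) + 1 = 0 := by
        rw [← Nat.cast_succ, Nat.succ_eq_add_one, Nat.sub_add_cancel hn, ZMod.natCast_self]
      rw [ZMod.val_natCast_of_lt (by omega), if_pos (by omega), key _ (by omega), hz, h0,
        ← pow_succ, Nat.sub_add_cancel hn] at this
      simpa using this
    · have : n = 1 := by omega
      exact ⟨lam, by rw [this, pow_one]⟩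
  · rintro ⟨a, rfl⟩
    refine ⟨fun x => a ^ x.val, fun x y => ?_⟩
    have hx := ZMod.val_lt x
    have hy := ZMod.val_lt y
    simp only [gammaL, mul_one]
    rw [eq_mul_inv_iff_mul_eq, ← pow_add, ZMod.val_add]
    split_ifs with hc
    · rw [Nat.mod_eq_sub_mod hc, Nat.mod_eq_of_lt (by omega), ← pow_add]
      congr 1
      omega
    · rw [Nat.mod_eq_of_lt (by omega), one_mul]
end

section
/- Let F_q be a finite field and n ≥ 1. Let C ⊆ F_q^n be a cyclic code, i.e. a 1-constacyclic code, identified via φ with an ideal of A = F_q[X]/(X^n − 1). Then C is LCD with respect to the Euclidean inner product, i.e. C ∩ C^⊥ = {0}, if and only if there exists e ∈ A with e² = e, τ(e) = e, and φ(C) equal to the ideal generated by e, where τ is the unique F_q-algebra endomorphism of A with τ(x) = x^{n−1}. -/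
open Polynomial AdjoinRoot

lemma aux_root_pow (F : Type*) [Field F] (n : ℕ) :
    root (X ^ n - Polynomial.C (1 : F)) ^ n = 1 := by
  have h := AdjoinRoot.eval₂_root (X ^ n - Polynomial.C (1 : F))
  simp only [eval₂_sub, eval₂_X_pow, map_one, eval₂_one] at h
  exact sub_eq_zero.mp h

lemma aux_phi_inj (F : Type*) [Field F] (n : ℕ) [NeZero n] :
    Function.Injective (phiMap F n (X ^ n - Polynomial.C (1 : F))) := by
  rw [injective_iff_map_eq_zero]
  intro c hc
  have hn : 0 < n := Nat.pos_of_ne_zero (NeZero.ne n)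
  have h1 : phiMap F n (X ^ n - Polynomial.C (1 : F)) c =
      AdjoinRoot.mk (X ^ n - Polynomial.C (1 : F)) (∑ i : Fin n, c i • X ^ (i : ℕ)) := by
    simp only [phiMap, LinearMap.coe_mk, AddHom.coe_mk, map_sum]
    refine Finset.sum_congr rfl fun i _ => ?_
    rw [Algebra.smul_def, Polynomial.smul_eq_C_mul, map_mul, map_pow, AdjoinRoot.mk_X,
      AdjoinRoot.mk_C, AdjoinRoot.algebraMap_eq]
  rw [h1, AdjoinRoot.mk_eq_zero] at hc
  have h2 : (∑ i : Fin n, c i • (X : F[X]) ^ (i : ℕ)) = 0 := by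
    refine Polynomial.eq_zero_of_dvd_of_degree_lt hc ?_
    rw [Polynomial.degree_X_pow_sub_C hn]
    refine lt_of_le_of_lt (Polynomial.degree_sum_le _ _) ?_
    refine (Finset.sup_lt_iff (WithBot.bot_lt_coe n)).mpr ?_
    intro i _
    refine lt_of_le_of_lt (Polynomial.degree_smul_le _ _) ?_
    rw [Polynomial.degree_X_pow]
    exact WithBot.coe_lt_coe.mpr i.2
  funext i
  have h3 := congrArg (fun p => Polynomial.coeff p (i : ℕ)) h2
  simp only [Polynomial.finsetSum_coeff, Polynomial.coeff_smul, Polynomial.coeff_X_pow,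
    Polynomial.coeff_zero, smul_eq_mul, mul_ite, mul_one, mul_zero] at h3
  rw [Finset.sum_eq_single i] at h3
  · simpa using h3
  · intro j _ hj
    rw [if_neg]
    intro h
    exact hj (Fin.ext h.symm)
  · simp

lemma aux_phi_surj (F : Type*) [Field F] (n : ℕ) [NeZero n] :
    Function.Surjective (phiMap F n (X ^ n - Polynomial.C (1 : F))) := by
  have hn : n ≠ 0 := NeZero.ne n
  have hm : (X ^ n - Polynomial.C (1 : F)).Monic := Polynomial.monic_X_pow_sub_C _ hn
  have hf : Module.finrank F (Fin n → F) =
      Module.finrank F (AdjoinRoot (X ^ n - Polynomial.C (1 : F))) := by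
    rw [(AdjoinRoot.powerBasis' hm).finrank, AdjoinRoot.powerBasis'_dim,
      Polynomial.natDegree_X_pow_sub_C]
    simp
  have : Module.Finite F (AdjoinRoot (X ^ n - Polynomial.C (1 : F))) :=
    (AdjoinRoot.powerBasis' hm).finite
  exact (LinearMap.injective_iff_surjective_of_finrank_eq_finrank hf).mp (aux_phi_inj F n)

lemma aux_tau_tau (F : Type*) [Field F] (n : ℕ) [NeZero n]
    (τ : AdjoinRoot (X ^ n - Polynomial.C (1 : F)) →ₐ[F]
        AdjoinRoot (X ^ n - Polynomial.C (1 : F)))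
    (hτ : τ (root (X ^ n - Polynomial.C (1 : F))) =
      root (X ^ n - Polynomial.C (1 : F)) ^ (n - 1)) (a) : τ (τ a) = a := by
  have h : τ.comp τ = AlgHom.id F _ := by
    apply AdjoinRoot.algHom_ext
    rw [AlgHom.comp_apply, hτ, map_pow, hτ, AlgHom.id_apply, ← pow_mul]
    obtain ⟨m, rfl⟩ : ∃ m, n = m + 1 := ⟨n - 1, by have := NeZero.pos n; omega⟩
    rcases m with _ | m
    · have := aux_root_pow F 1
      simpa using this.symm
    · have h2 : (m + 1 + 1 - 1) * (m + 1 + 1 - 1) = (m + 1 + 1) * m + 1 := by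
        simp only [Nat.add_sub_cancel]; ring
      rw [h2, pow_add _ ((m + 1 + 1) * m) 1, pow_mul, aux_root_pow, one_pow, one_mul, pow_one]
  exact DFunLike.congr_fun h a

lemma aux_pow (F : Type*) [Field F] (n : ℕ) [NeZero n] (k j : Fin n) :
    root (X ^ n - Polynomial.C (1 : F)) ^ ((j + k : Fin n) : ℕ) *
      root (X ^ n - Polynomial.C (1 : F)) ^ ((n - 1) * (j : ℕ)) =
    root (X ^ n - Polynomial.C (1 : F)) ^ (k : ℕ) := by
  have hp := aux_root_pow F n
  set x := root (X ^ n - Polynomial.C (1 : F))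
  have h1 : x ^ ((j + k : Fin n) : ℕ) = x ^ ((j : ℕ) + k) := by
    rw [Fin.val_add]
    conv_rhs => rw [← Nat.mod_add_div ((j : ℕ) + k) n, pow_add, pow_mul, hp, one_pow, mul_one]
  rw [h1, ← pow_add]
  have h2 : (j : ℕ) + k + (n - 1) * j = n * j + k := by
    obtain ⟨m, hm⟩ : ∃ m, n = m + 1 := ⟨n - 1, by have := NeZero.pos n; omega⟩
    have : n - 1 = m := by omega
    rw [this]
    nth_rewrite 4 [hm]
    ring
  rw [h2, pow_add, pow_mul, hp, one_pow, one_mul]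

lemma aux_corr (F : Type*) [Field F] (n : ℕ) [NeZero n]
    (τ : AdjoinRoot (X ^ n - Polynomial.C (1 : F)) →ₐ[F]
        AdjoinRoot (X ^ n - Polynomial.C (1 : F)))
    (hτ : τ (root (X ^ n - Polynomial.C (1 : F))) =
      root (X ^ n - Polynomial.C (1 : F)) ^ (n - 1)) (c y : Fin n → F) :
    phiMap F n (X ^ n - Polynomial.C (1 : F)) c *
      τ (phiMap F n (X ^ n - Polynomial.C (1 : F)) y) =
    phiMap F n (X ^ n - Polynomial.C (1 : F)) (fun k => ∑ j, c (j + k) * y j) := by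
  simp only [phiMap, LinearMap.coe_mk, AddHom.coe_mk, map_sum, map_smul, map_pow, hτ,
    Finset.sum_smul, ← pow_mul]
  rw [Finset.mul_sum, Finset.sum_comm (s := Finset.univ (α := Fin n))]
  refine Finset.sum_congr rfl fun j _ => ?_
  rw [Finset.sum_mul, ← Equiv.sum_comp (Equiv.addLeft j)]
  refine Finset.sum_congr rfl fun k _ => ?_
  rw [Equiv.coe_addLeft, smul_mul_smul_comm, aux_pow]

open Fin.NatCast Fin.CommRing in
lemma aux_shift (F : Type*) [Field F] (n : ℕ) [NeZero n] (C : Submodule F (Fin n → F))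
    (hC : IsConstacyclic (1 : F) C) (c : Fin n → F) (hc : c ∈ C) (k : Fin n) :
    (fun j => c (j + k)) ∈ C := by
  have h1 : ∀ c ∈ C, (fun j => c (j - 1)) ∈ C := by
    intro c hc
    have := hC c hc
    convert this using 1
    funext j
    simp [constaShift]
  have h2 : ∀ m : ℕ, (fun j => c (j - (m : Fin n))) ∈ C := by
    intro m
    induction m with
    | zero => simpa using hc
    | succ m ih =>
      have := h1 _ ih
      convert this using 3
      push_cast
      ring
  have h3 := h2 ((-k : Fin n) : ℕ)
  simpa using h3

lemma aux_dual_mul (F : Type*) [Field F] (n : ℕ) [NeZero n] (C : Submodule F (Fin n → F))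
    (hC : IsConstacyclic (1 : F) C)
    (τ : AdjoinRoot (X ^ n - Polynomial.C (1 : F)) →ₐ[F]
        AdjoinRoot (X ^ n - Polynomial.C (1 : F)))
    (hτ : τ (root (X ^ n - Polynomial.C (1 : F))) =
      root (X ^ n - Polynomial.C (1 : F)) ^ (n - 1)) (c y : Fin n → F)
    (hc : c ∈ C) (hy : y ∈ eucDual C) :
    phiMap F n (X ^ n - Polynomial.C (1 : F)) c *
      τ (phiMap F n (X ^ n - Polynomial.C (1 : F)) y) = 0 := by
  rw [aux_corr F n τ hτ]
  have : (fun k => ∑ j, c (j + k) * y j) = 0 := by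
    funext k
    exact hy _ (aux_shift F n C hC c hc k)
  rw [this, map_zero]

lemma aux_decomp (F : Type*) [Field F] (n : ℕ) [NeZero n] (C : Submodule F (Fin n → F))
    (h : C ⊓ eucDual C = ⊥) (u : Fin n → F) : ∃ e ∈ C, u - e ∈ eucDual C := by
  let B : (Fin n → F) →ₗ[F] Module.Dual F C :=
    LinearMap.mk₂ F (fun (y : Fin n → F) (c : C) => ∑ i, (c : Fin n → F) i * y i)
      (by intros; simp [mul_add, Finset.sum_add_distrib])
      (by intros; simp [Finset.mul_sum, mul_left_comm])
      (by intros; simp [add_mul, Finset.sum_add_distrib])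
      (by intros; simp [Finset.mul_sum, mul_assoc])
  have hB : ∀ y c, B y c = ∑ i, (c : Fin n → F) i * y i := fun _ _ => rfl
  let B' : C →ₗ[F] Module.Dual F C := B.comp C.subtype
  have hinj : Function.Injective B' := by
    rw [injective_iff_map_eq_zero]
    intro y hy
    have : (y : Fin n → F) ∈ C ⊓ eucDual C := by
      refine ⟨y.2, fun c hc => ?_⟩
      have := DFunLike.congr_fun hy ⟨c, hc⟩
      exact this
    rw [h] at this
    exact Subtype.ext this
  have hs : Function.Surjective B' :=
    (LinearMap.injective_iff_surjective_of_finrank_eq_finrank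
      (Subspace.dual_finrank_eq).symm).mp hinj
  obtain ⟨e, he⟩ := hs (B u)
  refine ⟨e, e.2, fun c hc => ?_⟩
  have h1 : B e ⟨c, hc⟩ = B u ⟨c, hc⟩ := DFunLike.congr_fun he ⟨c, hc⟩
  rw [hB, hB] at h1
  simp only [Pi.sub_apply, mul_sub, Finset.sum_sub_distrib]
  rw [sub_eq_zero]
  exact h1.symm

/-- Over a finite field `F_q`, a cyclic code `C ⊆ F_q^n` is LCD with
respect to the Euclidean inner product iff `φ(C)` is the ideal of `F_q[X]/(Xⁿ − 1)`
generated by an idempotent `e` with `τ(e) = e`, where `τ` is the classical involution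
(the algebra endomorphism with `τ(x) = x^{n−1}`). -/
theorem cyclic_lcd_iff_idempotent (F : Type*) [Field F] [Fintype F]
    (n : ℕ) [NeZero n] (C : Submodule F (Fin n → F)) (hC : IsConstacyclic (1 : F) C)
    (τ : AdjoinRoot (X ^ n - Polynomial.C (1 : F)) →ₐ[F]
        AdjoinRoot (X ^ n - Polynomial.C (1 : F)))
    (hτ : τ (root (X ^ n - Polynomial.C (1 : F))) =
      root (X ^ n - Polynomial.C (1 : F)) ^ (n - 1)) :
    C ⊓ eucDual C = ⊥ ↔
      ∃ e : AdjoinRoot (X ^ n - Polynomial.C (1 : F)),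
        e * e = e ∧ τ e = e ∧
          ((Ideal.span {e} : Ideal (AdjoinRoot (X ^ n - Polynomial.C (1 : F)))) :
              Set (AdjoinRoot (X ^ n - Polynomial.C (1 : F)))) =
            (phiMap F n (X ^ n - Polynomial.C (1 : F))) '' (C : Set (Fin n → F)) := by
  constructor
  · intro h
    obtain ⟨e, he, hf⟩ := aux_decomp F n C h (Pi.single 0 1)
    have h1 : phiMap F n (X ^ n - Polynomial.C (1 : F)) (Pi.single 0 1) = 1 := by
      simp only [phiMap, LinearMap.coe_mk, AddHom.coe_mk]
      rw [Finset.sum_eq_single 0]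
      · simp
      · intro j _ hj
        simp [hj]
      · simp
    have key : ∀ c ∈ C, phiMap F n (X ^ n - Polynomial.C (1 : F)) c *
        τ (phiMap F n (X ^ n - Polynomial.C (1 : F)) e) =
        phiMap F n (X ^ n - Polynomial.C (1 : F)) c := by
      intro c hc
      have := aux_dual_mul F n C hC τ hτ c _ hc hf
      rw [map_sub, h1, map_sub, map_one τ, mul_sub, mul_one, sub_eq_zero] at this
      exact this.symm
    have hk := key e he
    have hte : τ (phiMap F n (X ^ n - Polynomial.C (1 : F)) e) =
        phiMap F n (X ^ n - Polynomial.C (1 : F)) e := by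
      have h2 := congrArg τ hk
      rw [map_mul, aux_tau_tau F n τ hτ, mul_comm, hk] at h2
      exact h2.symm
    refine ⟨phiMap F n (X ^ n - Polynomial.C (1 : F)) e, ?_, hte, ?_⟩
    · rw [hte] at hk
      exact hk
    · ext a
      simp only [SetLike.mem_coe, Ideal.mem_span_singleton, Set.mem_image]
      constructor
      · rintro ⟨b, rfl⟩
        obtain ⟨y, hy⟩ := aux_phi_surj F n (τ b)
        refine ⟨_, ?_, ((aux_corr F n τ hτ e y).symm.trans
          (by rw [hy, aux_tau_tau F n τ hτ]))⟩
        have : (fun k => ∑ j, e (j + k) * y j) = ∑ j, y j • (fun k => e (k + j)) := by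
          funext k
          simp [add_comm, mul_comm]
        rw [this]
        exact Submodule.sum_mem _ fun j _ =>
          Submodule.smul_mem _ _ (aux_shift F n C hC e he j)
      · rintro ⟨c, hc, rfl⟩
        refine ⟨phiMap F n (X ^ n - Polynomial.C (1 : F)) c, ?_⟩
        have := key c hc
        rw [hte] at this
        rw [mul_comm]
        exact this.symm
  · rintro ⟨e, hee, hte, hI⟩
    rw [eq_bot_iff]
    rintro y ⟨hy, hy'⟩
    have he : e ∈ (phiMap F n (X ^ n - Polynomial.C (1 : F))) '' (C : Set (Fin n → F)) := by
      rw [← hI]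
      exact Ideal.mem_span_singleton_self e
    obtain ⟨c, hc, rfl⟩ := he
    have hy2 : phiMap F n (X ^ n - Polynomial.C (1 : F)) y ∈
        (phiMap F n (X ^ n - Polynomial.C (1 : F))) '' (C : Set (Fin n → F)) := ⟨y, hy, rfl⟩
    rw [← hI, SetLike.mem_coe, Ideal.mem_span_singleton] at hy2
    obtain ⟨a, ha⟩ := hy2
    have h0 := congrArg τ (aux_dual_mul F n C hC τ hτ c y hc hy')
    rw [map_mul, aux_tau_tau F n τ hτ, hte, map_zero, ha, ← mul_assoc, hee, ← ha] at h0
    have := aux_phi_inj F n (h0.trans (map_zero _).symm)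
    simpa using this
end

section
/- Let n ≥ 1 and let A be an abelian group (written multiplicatively) with trivial ZMod n-action. Then every 2-cocycle γ : ZMod n × ZMod n → A is cohomologous to γ_λ for some λ ∈ A; i.e. there exist λ ∈ A and δ : ZMod n → A such that γ(x,y) = δ(x)·δ(y)·δ(x+y)⁻¹·γ_λ(x,y) for all x, y ∈ ZMod n. -/
/-- For `n ≥ 1` and an abelian group `A` with trivial `ZMod n`-action,
every 2-cocycle `γ : ZMod n × ZMod n → A` is cohomologous to `γ_λ` for some `λ ∈ A`. -/
theorem cocycle_cohomologous_gammaL (n : ℕ) [NeZero n] (A : Type*) [CommGroup A]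
    (γ : ZMod n → ZMod n → A)
    (hγ : ∀ x y z : ZMod n, γ x y * γ (x + y) z = γ y z * γ x (y + z)) :
    ∃ lam : A, Cohomologous n γ (gammaL n lam) := by
  have h0 : ∀ x, γ x 0 = γ 0 0 := by
    intro x
    have h := hγ x 0 0
    simp only [add_zero] at h
    exact mul_right_cancel h
  let D : ℕ → A := fun k => γ 0 0 * (∏ i ∈ Finset.range k, γ (i : ZMod n) 1)⁻¹
  have D0 : D 0 = γ 0 0 := by simp [D]
  have Ds : ∀ k, D (k + 1) * γ (k : ZMod n) 1 = D k := by
    intro k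
    simp only [D, Finset.prod_range_succ, mul_inv, mul_assoc, inv_mul_cancel, mul_one]
  have key : ∀ a b : ℕ, γ (a : ZMod n) (b : ZMod n) * D (a + b) = D a * D b := by
    intro a b
    induction b with
    | zero => simp [h0, D0, mul_comm]
    | succ b ih =>
      have h := hγ a b 1
      have e1 := Ds (a + b)
      have e2 := Ds b
      push_cast at e1 ⊢
      rw [← add_assoc]
      rw [← e1, ← e2] at ih
      apply mul_left_cancel (a := γ (b : ZMod n) 1)
      calc γ (b : ZMod n) 1 * (γ a (b + 1) * D (a + b + 1))
          = (γ (b : ZMod n) 1 * γ a (b + 1)) * D (a + b + 1) := by rw [mul_assoc]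
        _ = γ a b * (D (a + b + 1) * γ (a + b) 1) := by
            rw [← h, mul_assoc, mul_comm (γ (a + b : ZMod n) 1)]
        _ = γ (b : ZMod n) 1 * (D a * D (b + 1)) := by
            rw [ih, ← mul_assoc, mul_comm]
  refine ⟨D 0 * (D n)⁻¹, fun x => D x.val, fun x y => ?_⟩
  have hxy := key x.val y.val
  simp only [ZMod.natCast_zmod_val] at hxy
  have hx := eq_mul_inv_of_mul_eq hxy
  unfold gammaL
  split_ifs with hn
  · have hv := ZMod.val_add_val_of_le hn
    have hm := key (x + y).val n
    rw [ZMod.natCast_self, h0, ← D0, ← hv] at hm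
    have hm' : D (x.val + y.val) = (D 0)⁻¹ * (D (x + y).val * D n) := by
      rw [← hm, hv]; simp
    rw [hx, hm']
    simp only [mul_inv_rev, inv_inv]
    simp only [mul_comm, mul_left_comm, mul_assoc]
  · beta_reduce
    rw [hx, ZMod.val_add_of_lt (not_le.mp hn), mul_one]
end
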